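/- For every nonnegative integer k, the number of 9-regular partitions of 16k+13 is even, i.e., b_9(16k+13) ≡ 0 (mod 2). -/

import Mathlib

/-- `numRegular ℓ n` is the number of `ℓ`-regular partitions of `n`,
i.e. partitions of `n` none of whose parts is divisible by `ℓ`. -/
def numRegular (ℓ n : ℕ) : ℕ :=
  (Finset.univ.filter fun p : Nat.Partition n => ∀ i ∈ p.parts, ¬ ℓ ∣ i).card

open PowerSeries Filter Finset

section FiniteGauss

variable {R : Type*} [CommRing R]

theorem gauss_triangular_telescope (q : R) (n m : ℕ) (hm : m ≤ n) :
    ∑ s ∈ range m, (∏ i ∈ range s, (1 - q ^ (2 * i + 1))) *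
        (∏ i ∈ Ico s (n + 1), (1 - q ^ (2 * i + 2))) * q ^ (s * (2 * n + 3)) =
      (1 - q ^ (2 * n + 1)) * ∑ s ∈ range m, (∏ i ∈ range s, (1 - q ^ (2 * i + 1))) *
        (∏ i ∈ Ico s n, (1 - q ^ (2 * i + 2))) * q ^ (s * (2 * n + 1)) +
      (∏ i ∈ range m, (1 - q ^ (2 * i + 1))) * (∏ i ∈ Ico m n, (1 - q ^ (2 * i + 2))) *
        (1 - q ^ (2 * m)) * q ^ (m * (2 * n + 1)) := by
  induction m with
  | zero => simp
  | succ m ih =>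
    rw [sum_range_succ, sum_range_succ, ih (by omega), prod_range_succ,
      prod_Ico_succ_top (by omega : m ≤ n), prod_eq_prod_Ico_succ_bot (by omega : m < n)]
    ring

/-- Shanks's finite form of Gauss's identity
`∑ q ^ (i * (i + 1) / 2) = ∏ (1 - q ^ (2 * i)) / (1 - q ^ (2 * i - 1))`. -/
theorem gauss_triangular_finite (q : R) (n : ℕ) :
    (∏ i ∈ range n, (1 - q ^ (2 * i + 1))) * ∑ i ∈ range (2 * n), q ^ (i * (i + 1) / 2) =
      ∑ s ∈ range n, (∏ i ∈ range s, (1 - q ^ (2 * i + 1))) *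
        (∏ i ∈ Ico s n, (1 - q ^ (2 * i + 2))) * q ^ (s * (2 * n + 1)) := by
  induction n with
  | zero => simp
  | succ n ih =>
    have h1 : 2 * n * (2 * n + 1) / 2 = n * (2 * n + 1) := by
      rw [mul_assoc, Nat.mul_div_cancel_left _ two_pos]
    have h2 : (2 * n + 1) * (2 * n + 1 + 1) / 2 = (n + 1) * (2 * n + 1) := by
      rw [show (2 * n + 1) * (2 * n + 1 + 1) = 2 * ((n + 1) * (2 * n + 1)) by ring,
        Nat.mul_div_cancel_left _ two_pos]
    have ht := gauss_triangular_telescope q n n le_rfl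
    rw [show 2 * (n + 1) = 2 * n + 1 + 1 by ring, sum_range_succ, sum_range_succ, h1, h2,
      prod_range_succ, sum_range_succ, show 2 * n + 1 + 1 + 1 = 2 * n + 3 by ring, ht, ← ih]
    simp only [Ico_self, prod_empty, Nat.Ico_succ_singleton, prod_singleton]
    ring

end FiniteGauss

section PowerSeriesAux

theorem powerSeries_eq_of_forall_X_pow_dvd_sub {R : Type*} [CommRing R] {f g : R⟦X⟧}
    (h : ∀ N : ℕ, X ^ N ∣ f - g) : f = g := by
  ext n
  have := X_pow_dvd_iff.mp (h (n + 1)) n n.lt_succ_self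
  rwa [map_sub, sub_eq_zero] at this

theorem eventually_X_pow_dvd_prod_one_sub_X_pow_sub (R : Type*) [CommRing R] (N : ℕ) :
    ∀ᶠ n in atTop, (X : R⟦X⟧) ^ N ∣
      ∏ i ∈ range n, (1 - X ^ (i + 1)) - pentagonalSeries R := by
  simp_rw [X_pow_dvd_iff, map_sub, sub_eq_zero]
  have h : ∀ m ∈ range N, ∀ᶠ n in atTop, (∏ i ∈ range n, (1 - X ^ (i + 1) : R⟦X⟧)).coeff m =
      (pentagonalSeries R).coeff m := fun m _ ↦
    tendsto_finset_range.eventually (coeff_prod_one_sub_X_pow_eventually_eq R m)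
  filter_upwards [(eventually_all_finset (range N)).mpr h] with n hn m hm
  exact hn m (mem_range.mpr hm)

theorem powerSeries_pow_two_pow (f : (ZMod 2)⟦X⟧) (k : ℕ) :
    f ^ 2 ^ k = expand (2 ^ k) (pow_ne_zero k two_ne_zero) f := by
  have h := MvPowerSeries.map_iterateFrobenius_expand (σ := Unit) 2 two_ne_zero f k
  rw [Subsingleton.elim (iterateFrobenius (ZMod 2) 2 k) (RingHom.id _), MvPowerSeries.map_id] at h
  exact h.symm

theorem coeff_pow_two_pow_eq_zero (f : (ZMod 2)⟦X⟧) (k : ℕ) {n : ℕ} (hn : ¬ 2 ^ k ∣ n) :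
    coeff n (f ^ 2 ^ k) = 0 := by
  rw [powerSeries_pow_two_pow, coeff_expand_of_not_dvd _ _ _ hn]

theorem X_pow_dvd_expand {R : Type*} [CommRing R] {f : R⟦X⟧} {N p : ℕ} (hp : p ≠ 0)
    (h : X ^ N ∣ f) : X ^ N ∣ expand p hp f := by
  obtain ⟨g, rfl⟩ := h
  rw [map_mul, map_pow, expand_X, ← pow_mul]
  exact (pow_dvd_pow _ (Nat.le_mul_of_pos_left N (Nat.pos_of_ne_zero hp))).mul_right _

theorem two_eq_zero_powerSeries_zmod_two : (2 : (ZMod 2)⟦X⟧) = 0 := by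
  rw [← map_ofNat (C (R := ZMod 2)) 2]
  exact (congrArg C (show (2 : ZMod 2) = 0 from rfl)).trans (map_zero C)

end PowerSeriesAux

section Triangular

/-- The series `∑ X ^ (a * (a + 1) / 2)` over `ZMod 2`. -/
noncomputable def triangularSeries : (ZMod 2)⟦X⟧ := by
  classical
  exact .mk fun n ↦ if ∃ a, a * (a + 1) / 2 = n then 1 else 0

theorem two_mul_triangular (a : ℕ) : 2 * (a * (a + 1) / 2) = a * (a + 1) :=
  Nat.two_mul_div_two_of_even (Nat.even_mul_succ_self a)

theorem triangular_injective {a b : ℕ} (h : a * (a + 1) / 2 = b * (b + 1) / 2) : a = b := by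
  have ha := two_mul_triangular a
  have hb := two_mul_triangular b
  nlinarith [lt_trichotomy a b]

theorem le_triangular (a : ℕ) : a ≤ a * (a + 1) / 2 := by
  cases a with
  | zero => simp
  | succ a =>
    have ha := two_mul_triangular (a + 1)
    nlinarith

theorem coeff_triangularSeries_triangular (a : ℕ) :
    coeff (a * (a + 1) / 2) triangularSeries = 1 := by
  rw [triangularSeries, coeff_mk, if_pos ⟨a, rfl⟩]

theorem coeff_triangularSeries_eq_zero {n : ℕ} (h : ∀ a, a * (a + 1) / 2 ≠ n) :
    coeff n triangularSeries = 0 := by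
  rw [triangularSeries, coeff_mk, if_neg (by simpa using h)]

theorem X_pow_dvd_triangularSeries_sub_sum {N M : ℕ} (h : N ≤ M) :
    X ^ N ∣ triangularSeries - ∑ a ∈ range M, X ^ (a * (a + 1) / 2) := by
  rw [X_pow_dvd_iff]
  intro m hm
  rw [map_sub, map_sum, sub_eq_zero]
  simp_rw [coeff_X_pow]
  by_cases hT : ∃ a, a * (a + 1) / 2 = m
  · obtain ⟨a, rfl⟩ := hT
    rw [coeff_triangularSeries_triangular, sum_eq_single a, if_pos rfl]
    · exact fun b _ hb ↦ if_neg fun hab ↦ hb (triangular_injective hab.symm)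
    · exact fun ha ↦ absurd (mem_range.mpr ((le_triangular a).trans_lt (hm.trans_le h))) ha
  · push Not at hT
    rw [coeff_triangularSeries_eq_zero hT, sum_eq_zero fun a _ ↦ if_neg (hT a).symm]

theorem X_pow_dvd_expand_triangularSeries_sub_sum {N M k : ℕ} (hk : k ≠ 0) (h : N ≤ M) :
    X ^ N ∣ expand k hk triangularSeries - ∑ a ∈ range M, X ^ (k * (a * (a + 1) / 2)) := by
  simpa [map_sub, map_sum, ← pow_mul] using
    X_pow_dvd_expand hk (X_pow_dvd_triangularSeries_sub_sum h)

theorem prod_one_sub_pow_two_mul {R : Type*} [CommRing R] (q : R) (n : ℕ) :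
    ∏ i ∈ range (2 * n), (1 - q ^ (i + 1)) =
      (∏ i ∈ range n, (1 - q ^ (2 * i + 1))) * ∏ i ∈ range n, (1 - q ^ (2 * i + 2)) := by
  induction n with
  | zero => simp
  | succ n ih =>
    rw [show 2 * (n + 1) = 2 * n + 1 + 1 by ring, prod_range_succ, prod_range_succ, ih,
      prod_range_succ, prod_range_succ]
    ring

theorem pentagonalSeries_ne_zero : pentagonalSeries (ZMod 2) ≠ 0 := by
  intro h
  have := coeff_pentagonalSeries_pentagonal (ZMod 2) 0
  simp [h] at this

theorem triangularSeries_eq_pentagonalSeries_pow_three :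
    triangularSeries = pentagonalSeries (ZMod 2) ^ 3 := by
  refine mul_left_cancel₀ pentagonalSeries_ne_zero ?_
  rw [← pow_succ']
  refine powerSeries_eq_of_forall_X_pow_dvd_sub fun N ↦ ?_
  have hev := eventually_X_pow_dvd_prod_one_sub_X_pow_sub (ZMod 2) N
  have hev2 := (tendsto_id.const_mul_atTop' (two_pos : 0 < 2)).eventually hev
  obtain ⟨n, h1, h2, hn⟩ := (hev.and (hev2.and (eventually_ge_atTop (N + 1)))).exists
  set F := ∏ i ∈ range n, (1 - X ^ (i + 1) : (ZMod 2)⟦X⟧) with hF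
  have hE : ∏ i ∈ range n, (1 - X ^ (2 * i + 2) : (ZMod 2)⟦X⟧) = F ^ 2 := by
    rw [hF, ← prod_pow]
    refine prod_congr rfl fun i _ ↦ ?_
    linear_combination (X ^ (i + 1) - X ^ (2 * i + 2)) * two_eq_zero_powerSeries_zmod_two
  have hT := X_pow_dvd_triangularSeries_sub_sum (N := N) (M := 2 * n) (by omega)
  have hG := gauss_triangular_finite (X : (ZMod 2)⟦X⟧) n
  have hsplit := prod_one_sub_pow_two_mul (X : (ZMod 2)⟦X⟧) n
  have hrest : X ^ N ∣ (∏ i ∈ range n, (1 - X ^ (2 * i + 1))) *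
      ∑ i ∈ range (2 * n), X ^ (i * (i + 1) / 2) - F ^ 2 := by
    obtain ⟨m, rfl⟩ : ∃ m, n = m + 1 := ⟨n - 1, by omega⟩
    rw [hG, sum_range_succ']
    simp only [range_zero, prod_empty, one_mul, zero_mul, pow_zero, mul_one]
    rw [← range_eq_Ico, hE, add_sub_cancel_right]
    refine dvd_sum fun s _ ↦ Dvd.dvd.mul_left (pow_dvd_pow _ ?_) _
    nlinarith
  rw [hE] at hsplit
  simp only [id] at h2
  rw [hsplit] at h2
  set D := ∏ i ∈ range n, (1 - X ^ (2 * i + 1) : (ZMod 2)⟦X⟧)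
  set S := ∑ i ∈ range (2 * n), (X : (ZMod 2)⟦X⟧) ^ (i * (i + 1) / 2)
  set P := pentagonalSeries (ZMod 2)
  have : P * triangularSeries - P ^ (3 + 1) = P * (triangularSeries - S) -
      S * (D * F ^ 2 - P) + F ^ 2 * (D * S - F ^ 2) + (F - P) * ((F + P) * (F ^ 2 + P ^ 2)) := by
    ring
  rw [this]
  exact (((hT.mul_left _).sub (h2.mul_left _)).add (hrest.mul_left _)).add (h1.mul_right _)

theorem exists_pentagonal_eq_iff (n : ℕ) :
    (∃ k, pentagonal k = n) ↔ ∃ a, a * (a + 1) / 2 = 3 * n := by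
  constructor
  · rintro ⟨k, rfl⟩
    have hk := two_mul_natCast_pentagonal k
    obtain ⟨a, ha⟩ : ∃ a : ℕ, (a : ℤ) * (a + 1) = 3 * k * (3 * k - 1) := by
      rcases lt_or_ge 0 k with h | h
      · exact ⟨(3 * k - 1).toNat, by rw [Int.toNat_of_nonneg (by omega)]; ring⟩
      · exact ⟨(-3 * k).toNat, by rw [Int.toNat_of_nonneg (by omega)]; ring⟩
    refine ⟨a, ?_⟩
    have ht := two_mul_triangular a
    zify at ht ⊢
    linarith
  · rintro ⟨a, ha⟩
    have ht := two_mul_triangular a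
    rw [ha] at ht
    obtain ⟨k, hk⟩ : ∃ k : ℤ, 3 * k * (3 * k - 1) = a * (a + 1) := by
      obtain ⟨c, hc | hc | hc⟩ : ∃ c, a = 3 * c ∨ a = 3 * c + 1 ∨ a = 3 * c + 2 :=
        ⟨a / 3, by omega⟩
      · exact ⟨-c, by rw [hc]; push_cast; ring⟩
      · rw [hc] at ht
        ring_nf at ht
        omega
      · exact ⟨c + 1, by rw [hc]; push_cast; ring⟩
    refine ⟨k, ?_⟩
    have hp := two_mul_natCast_pentagonal k
    zify at ht ⊢
    linarith

theorem coeff_pentagonalSeries_zmod_two (n : ℕ) :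
    coeff n (pentagonalSeries (ZMod 2)) = coeff (3 * n) triangularSeries := by
  by_cases h : ∃ k, pentagonal k = n
  · obtain ⟨a, ha⟩ := (exists_pentagonal_eq_iff n).mp h
    obtain ⟨k, rfl⟩ := h
    rw [← ha, coeff_triangularSeries_triangular, coeff_pentagonalSeries_pentagonal]
    rcases Int.even_or_odd k with hk | hk
    · simp [Int.negOnePow_even k hk]
    · simp [Int.negOnePow_odd k hk]
  · rw [coeff_pentagonalSeries_eq_zero _ h, coeff_triangularSeries_eq_zero]
    simpa [exists_pentagonal_eq_iff] using h

theorem triangular_three_mul_add_one (c : ℕ) :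
    (3 * c + 1) * (3 * c + 1 + 1) / 2 = 9 * (c * (c + 1) / 2) + 1 := by
  have h1 := two_mul_triangular (3 * c + 1)
  have h2 := two_mul_triangular c
  nlinarith

theorem triangular_eq_of_not_three_dvd {a : ℕ} (h : ¬ 3 ∣ a * (a + 1) / 2) :
    ∃ c, a = 3 * c + 1 := by
  by_contra! hc
  refine h ((Nat.Coprime.dvd_mul_left (by norm_num : Nat.Coprime 3 2)).mp ?_)
  rw [two_mul_triangular]
  rcases (by have := hc (a / 3); omega : 3 ∣ a ∨ 3 ∣ a + 1) with h | h
  · exact h.mul_right _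
  · exact h.mul_left _

theorem triangularSeries_three_dissection :
    triangularSeries = expand 3 three_ne_zero (pentagonalSeries (ZMod 2)) +
      X * expand 9 (by norm_num) triangularSeries := by
  ext n
  rw [map_add]
  by_cases h3 : 3 ∣ n
  · obtain ⟨m, rfl⟩ := h3
    rw [coeff_expand_mul, coeff_pentagonalSeries_zmod_two]
    cases m with
    | zero => simp
    | succ m =>
      rw [show 3 * (m + 1) = 3 * m + 2 + 1 by ring, coeff_succ_X_mul,
        coeff_expand_of_not_dvd _ _ _ (by omega), add_zero]
  · rw [coeff_expand_of_not_dvd _ _ _ h3, zero_add]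
    obtain ⟨n, rfl⟩ := Nat.exists_eq_succ_of_ne_zero (show n ≠ 0 by rintro rfl; simp at h3)
    rw [Nat.succ_eq_add_one, coeff_succ_X_mul, coeff_expand]
    by_cases hT : ∃ a, a * (a + 1) / 2 = n + 1
    · obtain ⟨a, ha⟩ := hT
      obtain ⟨c, rfl⟩ := triangular_eq_of_not_three_dvd (a := a) (by rwa [ha])
      rw [← ha, coeff_triangularSeries_triangular]
      rw [triangular_three_mul_add_one, Nat.add_right_cancel_iff] at ha
      rw [← ha, if_pos (Nat.dvd_mul_right _ _), Nat.mul_div_cancel_left _ (by norm_num),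
        coeff_triangularSeries_triangular]
    · push Not at hT
      rw [coeff_triangularSeries_eq_zero hT]
      split_ifs with h9
      · obtain ⟨m, rfl⟩ := h9
        rw [Nat.mul_div_cancel_left _ (by norm_num), coeff_triangularSeries_eq_zero]
        rintro c rfl
        exact hT _ (triangular_three_mul_add_one c)
      · rfl

/-- An involution preserving `a * (a + 1) + 3 * b * (b + 1)`. With `u = 2 * a + 1` and
`v = ± (2 * b + 1)`, the sign chosen so that `u ≡ v` modulo `4`, it sends `(u, v)` to
`(|3 * v - u| / 2, |u + v| / 2)`. -/
def triangularInvolution (p : ℕ × ℕ) : ℕ × ℕ :=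
  if p.1 % 2 = p.2 % 2 then
    (if p.1 ≤ 3 * p.2 then (3 * p.2 - p.1) / 2 else (p.1 - 3 * p.2 - 2) / 2, (p.1 + p.2) / 2)
  else
    ((3 * p.2 + p.1 + 1) / 2, if p.2 ≤ p.1 then (p.1 - p.2 - 1) / 2 else (p.2 - p.1 - 1) / 2)

theorem triangularInvolution_involutive (p : ℕ × ℕ) :
    triangularInvolution (triangularInvolution p) = p := by
  obtain ⟨a, b⟩ := p
  unfold triangularInvolution
  ext <;> grind

theorem triangularInvolution_eq_self_iff (p : ℕ × ℕ) :
    triangularInvolution p = p ↔ p.1 = p.2 ∨ p.1 = 3 * p.2 + 1 := by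
  obtain ⟨a, b⟩ := p
  unfold triangularInvolution
  rw [Prod.ext_iff]
  grind

theorem triangularInvolution_form (p : ℕ × ℕ) :
    (triangularInvolution p).1 * ((triangularInvolution p).1 + 1) / 2 +
      3 * ((triangularInvolution p).2 * ((triangularInvolution p).2 + 1) / 2) =
    p.1 * (p.1 + 1) / 2 + 3 * (p.2 * (p.2 + 1) / 2) := by
  obtain ⟨a, b⟩ := p
  set q := triangularInvolution (a, b) with hq
  obtain ⟨w, hw, h1, h2⟩ : ∃ w : ℤ, (w = 2 * b + 1 ∨ w = -(2 * b + 1)) ∧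
      (2 * (2 * q.1 + 1) = 3 * w - (2 * a + 1) ∨ 2 * (2 * q.1 + 1) = -(3 * w - (2 * a + 1))) ∧
      (2 * (2 * q.2 + 1) = 2 * a + 1 + w ∨ 2 * (2 * q.2 + 1) = -(2 * a + 1 + w)) := by
    by_cases hab : a % 2 = b % 2
    · refine ⟨2 * b + 1, .inl rfl, ?_⟩
      simp only [hq, triangularInvolution, if_pos hab]
      split_ifs <;> omega
    · refine ⟨-(2 * b + 1), .inr rfl, ?_⟩
      simp only [hq, triangularInvolution, if_neg hab]
      split_ifs <;> omega
  rw [← sq_eq_sq_iff_eq_or_eq_neg] at hw h1 h2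
  have t1 := two_mul_triangular a
  have t2 := two_mul_triangular b
  have t3 := two_mul_triangular q.1
  have t4 := two_mul_triangular q.2
  dsimp only
  zify at t1 t2 t3 t4 ⊢
  linarith

theorem coeff_eq_of_X_pow_dvd_sub {R : Type*} [CommRing R] {f g : R⟦X⟧} {n : ℕ}
    (h : X ^ (n + 1) ∣ f - g) : coeff n f = coeff n g := by
  have := X_pow_dvd_iff.mp h n n.lt_succ_self
  rwa [map_sub, sub_eq_zero] at this

theorem sum_triangular_pairs (n : ℕ) :
    ∑ a ∈ range (n + 1), ∑ b ∈ range (n + 1),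
        (if n = a * (a + 1) / 2 + 3 * (b * (b + 1) / 2) then (1 : ZMod 2) else 0) =
      ∑ a ∈ range (n + 1), (if n = 4 * (a * (a + 1) / 2) then 1 else 0) +
        ∑ b ∈ range (n + 1), (if n = 12 * (b * (b + 1) / 2) + 1 then 1 else 0) := by
  set K := (range (n + 1) ×ˢ range (n + 1)).filter
    fun p ↦ n = p.1 * (p.1 + 1) / 2 + 3 * (p.2 * (p.2 + 1) / 2) with hK
  have hmem (p : ℕ × ℕ) : p ∈ K ↔ n = p.1 * (p.1 + 1) / 2 + 3 * (p.2 * (p.2 + 1) / 2) := by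
    have h1 := le_triangular p.1
    have h2 := le_triangular p.2
    simp only [hK, mem_filter, mem_product, mem_range]
    omega
  have hzero : ∑ p ∈ K, ((1 : ZMod 2) - (if p.1 = p.2 then 1 else 0) -
      (if p.1 = 3 * p.2 + 1 then 1 else 0)) = 0 := by
    refine sum_involution (fun p _ ↦ triangularInvolution p) ?_ ?_ ?_ ?_
    · intro p _
      by_cases hp : triangularInvolution p = p
      · rw [hp, CharTwo.add_self_eq_zero]
      · have hp' : triangularInvolution (triangularInvolution p) ≠ triangularInvolution p := by
          rw [triangularInvolution_involutive]
          exact Ne.symm hp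
        rw [Ne, triangularInvolution_eq_self_iff, not_or] at hp'
        rw [triangularInvolution_eq_self_iff, not_or] at hp
        rw [if_neg hp.1, if_neg hp.2, if_neg hp'.1, if_neg hp'.2]
        rfl
    · intro p _ h0 hp
      rcases (triangularInvolution_eq_self_iff p).mp hp with h | h
      · exact h0 (by rw [if_pos h, if_neg (by omega)]; rfl)
      · exact h0 (by rw [if_pos h, if_neg (by omega)]; rfl)
    · intro p hp
      rw [hmem] at hp ⊢
      rw [triangularInvolution_form, ← hp]
    · exact fun p _ ↦ triangularInvolution_involutive p
  rw [sum_sub_distrib, sum_sub_distrib, sub_sub, sub_eq_zero] at hzero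
  rw [← sum_product', ← sum_filter, ← hK, hzero]
  congr 1
  · rw [← sum_filter, ← sum_filter]
    refine sum_nbij' Prod.fst (fun a ↦ (a, a)) ?_ ?_ ?_ ?_ ?_
    · rintro ⟨a, b⟩ h
      have := le_triangular a
      simp only [mem_filter, hmem, mem_range] at h ⊢
      rw [← h.2] at h
      omega
    · intro a h
      simp only [mem_filter, hmem, mem_range, and_true] at h ⊢
      omega
    · rintro ⟨a, b⟩ h
      simp only [mem_filter] at h
      rw [h.2]
    · simp
    · simp
  · rw [← sum_filter, ← sum_filter]
    refine sum_nbij' Prod.snd (fun b ↦ (3 * b + 1, b)) ?_ ?_ ?_ ?_ ?_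
    · rintro ⟨a, b⟩ h
      have := le_triangular b
      simp only [mem_filter, hmem, mem_range] at h ⊢
      rw [h.2, triangular_three_mul_add_one] at h
      omega
    · intro b h
      simp only [mem_filter, hmem, mem_range, triangular_three_mul_add_one, and_true] at h ⊢
      omega
    · rintro ⟨a, b⟩ h
      simp only [mem_filter] at h
      rw [h.2]
    · simp
    · simp

theorem triangularSeries_mul_expand_three :
    triangularSeries * expand 3 three_ne_zero triangularSeries =
      expand 4 four_ne_zero triangularSeries +
        X * expand 12 (by norm_num) triangularSeries := by
  ext n
  have h1 := X_pow_dvd_triangularSeries_sub_sum (le_refl (n + 1))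
  have h3 := X_pow_dvd_expand_triangularSeries_sub_sum three_ne_zero (le_refl (n + 1))
  have h4 := X_pow_dvd_expand_triangularSeries_sub_sum four_ne_zero (le_refl (n + 1))
  have h12 := X_pow_dvd_expand_triangularSeries_sub_sum (k := 12) (by norm_num) (le_refl (n + 1))
  have hL := coeff_eq_of_X_pow_dvd_sub (dvd_mul_sub_mul h1 h3)
  have hR := coeff_eq_of_X_pow_dvd_sub <| (h4.add (h12.mul_left X)).trans
    (by rw [mul_sub, sub_add_sub_comm])
  rw [hL, hR, sum_mul_sum, map_add, mul_sum, map_sum, map_sum, map_sum]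
  simp only [map_sum, ← pow_add, ← pow_succ', coeff_X_pow]
  exact sum_triangular_pairs n

end Triangular

section Main

theorem char_two_field_identity {K : Type*} [Field K] (h2 : (2 : K) = 0) {q x y z : K}
    (hq : q ≠ 0) (hx : x ≠ 0) (hy : y ≠ 0) (hz : z ≠ 0)
    (hD : x ^ 3 = y + q * z ^ 3) (hT : x ^ 3 * y ^ 3 = x ^ 12 + q * y ^ 12) :
    z * x⁻¹ = (y ^ 5 * x⁻¹ ^ 2 * z⁻¹) ^ 2 + q * (x * y ^ 4 * z⁻¹) ^ 8 +
      q ^ 5 * (x ^ 2 * z * y⁻¹) ^ 16 + q ^ 3 * (y ^ 4 * z * x⁻¹) ^ 4 := by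
  have hA : x ^ 3 * z ^ 3 * y ^ 2 = y ^ 12 + q * x ^ 6 * z ^ 6 := by
    refine mul_left_cancel₀ hq ?_
    linear_combination (-x ^ 3 * y ^ 2 + x ^ 6 * (q * z ^ 3 + x ^ 3 - y)) * hD + hT +
      (x ^ 9 * y - x ^ 3 * y ^ 3) * h2
  have h1 : z * x⁻¹ = (y ^ 5 * x⁻¹ ^ 2 * z⁻¹) ^ 2 + q * (x * z ^ 2 * y⁻¹) ^ 2 := by
    field_simp
    linear_combination hA
  have h3 : x * z ^ 2 * y⁻¹ = (x ^ 5 * z * y⁻¹ ^ 2) ^ 2 + q * (y ^ 4 * z * x⁻¹) ^ 2 := by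
    field_simp
    linear_combination hT
  have h4 : x ^ 5 * z * y⁻¹ ^ 2 = (x * y ^ 4 * z⁻¹) ^ 2 + q * (x ^ 2 * z * y⁻¹) ^ 4 := by
    field_simp
    linear_combination hA
  have sq_add (a b : K) : (a + b) ^ 2 = a ^ 2 + b ^ 2 := by linear_combination a * b * h2
  rw [h1, h3, sq_add, h4, sq_add, sq_add]
  ring

theorem char_two_identity {R : Type*} [CommRing R] [IsDomain R] (h2 : (2 : R) = 0)
    {q x y z x' y' z' B : R} (hq : q ≠ 0) (hx : x * x' = 1) (hy : y * y' = 1) (hz : z * z' = 1)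
    (hD : x ^ 3 = y + q * z ^ 3) (hT : x ^ 3 * y ^ 3 = x ^ 12 + q * y ^ 12) (hB : B * x = z) :
    B = (y ^ 5 * x' ^ 2 * z') ^ 2 + q * (x * y ^ 4 * z') ^ 8 +
      q ^ 5 * (x ^ 2 * z * y') ^ 16 + q ^ 3 * (y ^ 4 * z * x') ^ 4 := by
  let φ := algebraMap R (FractionRing R)
  have hφ : Function.Injective φ := IsFractionRing.injective R (FractionRing R)
  have hinv {a b : R} (h : a * b = 1) : φ b = (φ a)⁻¹ :=
    eq_inv_of_mul_eq_one_right (by rw [← map_mul, h, map_one])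
  have hne {a b : R} (h : a * b = 1) : φ a ≠ 0 :=
    (map_ne_zero_iff φ hφ).mpr (left_ne_zero_of_mul_eq_one h)
  have hB' : B = z * x' := by linear_combination x' * hB - B * hx
  apply hφ
  rw [hB']
  simp only [map_add, map_mul, map_pow, hinv hx, hinv hy, hinv hz]
  exact char_two_field_identity (by rw [← map_ofNat φ 2, h2, map_zero])
    ((map_ne_zero_iff φ hφ).mpr hq) (hne hx) (hne hy) (hne hz)
    (by simpa using congrArg φ hD) (by simpa using congrArg φ hT)

open scoped WithPiTopology in
theorem hasProd_expand {R : Type*} [CommRing R] [TopologicalSpace R] {p : ℕ} (hp : p ≠ 0)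
    {f : ℕ → R⟦X⟧} {g : R⟦X⟧} (h : HasProd f g) :
    HasProd (fun i ↦ expand p hp (f i)) (expand p hp g) := by
  refine h.map (expand p hp) ?_
  refine continuous_iff_continuousAt.mpr fun a ↦ ?_
  rw [ContinuousAt, WithPiTopology.tendsto_iff_coeff_tendsto]
  intro d
  simp only [coeff_expand]
  split_ifs
  · exact (WithPiTopology.continuous_coeff R _).continuousAt
  · exact tendsto_const_nhds

open scoped WithPiTopology in
theorem mk_numRegular_mul_pentagonalSeries {m : ℕ} (hm : 0 < m) :
    (PowerSeries.mk fun n ↦ (numRegular m n : ZMod 2)) * pentagonalSeries (ZMod 2) =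
      expand m hm.ne' (pentagonalSeries (ZMod 2)) := by
  let : TopologicalSpace (ZMod 2) := ⊥
  have : DiscreteTopology (ZMod 2) := ⟨rfl⟩
  have hB := Nat.Partition.hasProd_powerSeriesMk_card_countRestricted (ZMod 2) hm
  rw [← Nat.Partition.powerSeriesMk_card_restricted_eq_powerSeriesMk_card_countRestricted
    (ZMod 2) hm] at hB
  have hP := WithPiTopology.hasProd_one_sub_X_pow (ZMod 2)
  have hBP := hB.mul hP
  have hterm (i : ℕ) : (∑ j ∈ range m, (X : (ZMod 2)⟦X⟧) ^ ((i + 1) * j)) * (1 - X ^ (i + 1)) =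
      expand m hm.ne' (1 - X ^ (i + 1)) := by
    rw [map_sub, map_one, map_pow, expand_X]
    simp_rw [pow_mul, geom_sum_mul_neg]
    rw [← pow_mul, ← pow_mul, mul_comm]
  simp_rw [hterm] at hBP
  exact hBP.unique (hasProd_expand hm.ne' hP)

end Main

/-- For every nonnegative integer `k`, `b_9(16k+13)` is even. -/
theorem b9_sixteen_k_thirteen_even (k : ℕ) : 2 ∣ numRegular 9 (16 * k + 13) := by
  set P := pentagonalSeries (ZMod 2)
  have hconst : P.constantCoeff = 1 := by
    simpa [pentagonal] using coeff_pentagonalSeries_pentagonal (ZMod 2) 0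
  have hinv {f : (ZMod 2)⟦X⟧} (hf : f.constantCoeff = 1) : f * f⁻¹ = 1 :=
    PowerSeries.mul_inv_cancel f (by rw [hf]; exact one_ne_zero)
  have hcube {p : ℕ} (hp : p ≠ 0) : expand p hp triangularSeries = expand p hp P ^ 3 := by
    rw [triangularSeries_eq_pentagonalSeries_pow_three, map_pow]
  have hD := triangularSeries_three_dissection
  have hT := triangularSeries_mul_expand_three
  have h4 : expand 4 four_ne_zero P = P ^ 4 := (powerSeries_pow_two_pow P 2).symm
  have h12 : expand 12 (by norm_num) P = (expand 3 three_ne_zero P) ^ 4 := by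
    rw [show 4 = 2 ^ 2 by norm_num, powerSeries_pow_two_pow _ 2, ← expand_mul]
    rfl
  rw [hcube, triangularSeries_eq_pentagonalSeries_pow_three] at hD
  rw [hcube, hcube, hcube, triangularSeries_eq_pentagonalSeries_pow_three, h4, h12, ← pow_mul,
    ← pow_mul] at hT
  have key := char_two_identity two_eq_zero_powerSeries_zmod_two X_ne_zero (hinv hconst)
    (hinv (by rw [constantCoeff_expand, hconst])) (hinv (by rw [constantCoeff_expand, hconst]))
    hD hT (mk_numRegular_mul_pentagonalSeries (m := 9) (by norm_num))
  have := congrArg (coeff (16 * k + 13)) key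
  have hc {e j : ℕ} (f : (ZMod 2)⟦X⟧) (he : e ≤ 13) (h : ¬ 2 ^ j ∣ 16 * k + 13 - e) :
      coeff (16 * k + 13) (X ^ e * f ^ 2 ^ j) = 0 := by
    rw [coeff_X_pow_mul', if_pos (by omega), coeff_pow_two_pow_eq_zero f j h]
  rw [coeff_mk, map_add, map_add, map_add] at this
  have c1 := fun f ↦ hc (e := 0) (j := 1) f (by omega) (by omega)
  have c2 := fun f ↦ hc (e := 1) (j := 3) f (by omega) (by omega)
  have c3 := fun f ↦ hc (e := 5) (j := 4) f (by omega) (by omega)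
  have c4 := fun f ↦ hc (e := 3) (j := 2) f (by omega) (by omega)
  norm_num only [pow_zero, one_mul, pow_one] at c1 c2 c3 c4
  rw [c1, c2, c3, c4, add_zero, add_zero, add_zero] at this
  exact (ZMod.natCast_eq_zero_iff _ _).mp this
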